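/- Let K_p, K_d, K_i ∈ ℝ be such that the matrix A with rows (0,1,0), (K_p, K_d, 1), (K_i, 0, 0) is Hurwitz, and let c₁, c₂ > 0. For μ ∈ (−1/2,0) let g_μ be the hPID closed-loop vector field built from the explicit norm h_μ(ξ₁,ξ₂) = c₁|ξ₁|^{1/(1−μ)} + c₂|ξ₂|. Then there exists ε ∈ (0, 1/2] such that for every μ with −ε < μ < 0, the system ẋ = g_μ(x) is globally finite-time stable: it is Lyapunov stable, and for every differentiable x : [0,∞) → ℝ³ with x′(t) = g_μ(x(t)) for all t ≥ 0 there exists T ≥ 0 such that x(t) = 0 for all t ≥ T. -/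

import Mathlib

open Matrix Filter

/-- Euclidean norm on `Fin 3 → ℝ`. -/
noncomputable def eucNorm3 (x : Fin 3 → ℝ) : ℝ :=
  Real.sqrt (∑ i, (x i) ^ 2)

/-- The explicit `d_μ`-homogeneous norm `h_μ(ξ₁, ξ₂) = c₁|ξ₁|^{1/(1−μ)} + c₂|ξ₂|`. -/
noncomputable def hmu (c₁ c₂ μ : ℝ) (ξ : Fin 2 → ℝ) : ℝ :=
  c₁ * |ξ 0| ^ (1 / (1 - μ)) + c₂ * |ξ 1|

/-- The hPID closed-loop vector field built from the explicit norm `h_μ`. -/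
noncomputable def gmu (Kp Kd Ki c₁ c₂ μ : ℝ) (x : Fin 3 → ℝ) : Fin 3 → ℝ :=
  ![x 1,
    Kp * hmu c₁ c₂ μ ![x 0, x 1] ^ (2 * μ) * x 0 +
      Kd * hmu c₁ c₂ μ ![x 0, x 1] ^ μ * x 1 + x 2,
    Ki * hmu c₁ c₂ μ ![x 0, x 1] ^ (3 * μ) * x 0]

/-- The cubic `z³ - Kd z² - Kp z - Ki` is the characteristic polynomial of the PID matrix. -/
theorem mem_spectrum_pid {Kp Kd Ki : ℝ} {z : ℂ}
    (hz : z ^ 3 - Kd * z ^ 2 - Kp * z - Ki = 0) :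
    z ∈ spectrum ℂ ((Matrix.of ![![0, 1, 0], ![Kp, Kd, 1], ![Ki, 0, 0]] :
      Matrix (Fin 3) (Fin 3) ℝ).map (algebraMap ℝ ℂ)) := by
  rw [Matrix.mem_spectrum_iff_isRoot_charpoly, Polynomial.IsRoot.def, Matrix.eval_charpoly,
    Matrix.det_fin_three]
  simp [Matrix.scalar_apply]
  linear_combination hz

/-- A real cubic of Hurwitz type splits as `(s + p)(s² + m s + n)` with `p, m, n > 0`. -/
theorem exists_pos_factor_of_hurwitz {Kp Kd Ki : ℝ}
    (h : ∀ z : ℂ, z ^ 3 - Kd * z ^ 2 - Kp * z - Ki = 0 → z.re < 0) :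
    ∃ p m n : ℝ, 0 < p ∧ 0 < m ∧ 0 < n ∧
      Kd = -(p + m) ∧ Kp = -(p * m + n) ∧ Ki = -(p * n) := by
  have hreal : ∀ s : ℝ, s ^ 3 - Kd * s ^ 2 - Kp * s - Ki = 0 → s < 0 := fun s hs => by
    simpa using h s (by exact_mod_cast hs)
  obtain ⟨s, hs⟩ : ∃ s : ℝ, s ^ 3 - Kd * s ^ 2 - Kp * s - Ki = 0 := by
    obtain ⟨R, hR⟩ : ∃ R, R = 1 + |Kd| + |Kp| + |Ki| := ⟨_, rfl⟩
    have hd := abs_nonneg Kd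
    have hp := abs_nonneg Kp
    have hi := abs_nonneg Ki
    have hR1 : 1 ≤ R := by linarith
    have hR2 : R ≤ R ^ 2 := by nlinarith
    have hcube : R ^ 3 = R ^ 2 + |Kd| * R ^ 2 + |Kp| * R ^ 2 + |Ki| * R ^ 2 := by
      linear_combination R ^ 2 * hR
    have bd : |Kd * R ^ 2| ≤ |Kd| * R ^ 2 := by rw [abs_mul, abs_of_nonneg (sq_nonneg R)]
    have bp : |Kp * R| ≤ |Kp| * R ^ 2 := by
      rw [abs_mul, abs_of_nonneg (by linarith : 0 ≤ R)]
      exact mul_le_mul_of_nonneg_left hR2 hp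
    have bi : |Ki| ≤ |Ki| * R ^ 2 := by nlinarith
    rw [abs_le] at bd bp
    have bi' := abs_le.1 bi
    have hmem : (0:ℝ) ∈ Set.Icc ((-R) ^ 3 - Kd * (-R) ^ 2 - Kp * (-R) - Ki)
        (R ^ 3 - Kd * R ^ 2 - Kp * R - Ki) := by
      constructor <;> nlinarith
    obtain ⟨s, -, hs⟩ := intermediate_value_Icc (by linarith : -R ≤ R)
      (f := fun s => s ^ 3 - Kd * s ^ 2 - Kp * s - Ki) (by fun_prop) hmem
    exact ⟨s, hs⟩
  have hs0 := hreal s hs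
  obtain ⟨m, hm⟩ : ∃ m, m = s - Kd := ⟨_, rfl⟩
  obtain ⟨n, hn⟩ : ∃ n, n = s * m - Kp := ⟨_, rfl⟩
  have hfac : ∀ z : ℂ, z ^ 2 + m * z + n = 0 → z.re < 0 := fun z hz => by
    apply h
    have hsC : (s : ℂ) ^ 3 - Kd * s ^ 2 - Kp * s - Ki = 0 := by exact_mod_cast hs
    subst hn; subst hm
    push_cast at hz
    linear_combination (z - s) * hz + hsC
  have hfac' : ∀ z : ℝ, z ^ 2 + m * z + n = 0 → z < 0 := fun z hz => by
    simpa using hfac z (by exact_mod_cast hz)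
  have hmn : 0 < m ∧ 0 < n := by
    rcases le_or_gt 0 (m ^ 2 - 4 * n) with hd | hd
    · have hsq := Real.sq_sqrt hd
      have h0 := Real.sqrt_nonneg (m ^ 2 - 4 * n)
      have h1 := hfac' ((-m + √(m ^ 2 - 4 * n)) / 2) (by linear_combination hsq / 4)
      have hm0 : 0 < m := by linarith
      exact ⟨hm0, by nlinarith⟩
    · have hsq := Real.sq_sqrt (show 0 ≤ 4 * n - m ^ 2 by linarith)
      generalize √(4 * n - m ^ 2) = q at hsq
      have h1 := hfac ⟨-m / 2, q / 2⟩ (by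
        apply Complex.ext
        · simp [pow_two]
          linear_combination -hsq / 4
        · simp [pow_two]
          ring)
      simp only at h1
      exact ⟨by linarith, by nlinarith [sq_nonneg m]⟩
  refine ⟨-s, m, n, by linarith, hmn.1, hmn.2, by linarith, by linarith, ?_⟩
  subst hn; subst hm
  linear_combination -hs

/-- Weighted AM-GM bound for the deviation of `h ^ (-θ)` from `1`. -/
theorem abs_rpow_neg_sub_one_mul_le {h H C X θ : ℝ} (h0 : 0 ≤ h) (hH : h ≤ H) (hH1 : 1 ≤ H)
    (hθ0 : 0 ≤ θ) (hθ1 : θ < 1) (hX0 : 0 ≤ X) (hX : h ≤ 1 → X ≤ C * h) (hXH : X ≤ H)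
    (hC : 0 ≤ C) : |(h ^ (-θ) - 1)| * X ≤ (C + H * Real.log H) * θ := by
  have hlog : 0 ≤ Real.log H := Real.log_nonneg hH1
  rcases h0.eq_or_lt with rfl | hpos
  · have : X = 0 := le_antisymm (by simpa using hX zero_le_one) hX0
    rw [this, mul_zero]; positivity
  rcases le_or_gt h 1 with h1 | h1
  · have hge : 1 ≤ h ^ (-θ) := Real.one_le_rpow_of_pos_of_le_one_of_nonpos hpos h1 (by linarith)
    have hag := Real.geom_mean_le_arith_mean2_weighted (w₁ := 1 - θ) (w₂ := θ) (p₁ := h) (p₂ := 1)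
      (by linarith) hθ0 h0 zero_le_one (by ring)
    have hsplit : h ^ (1 - θ) = h * h ^ (-θ) := by
      rw [sub_eq_add_neg, Real.rpow_add hpos, Real.rpow_one]
    rw [Real.one_rpow, hsplit] at hag
    rw [abs_of_nonneg (by linarith)]
    calc (h ^ (-θ) - 1) * X ≤ (h ^ (-θ) - 1) * (C * h) :=
          mul_le_mul_of_nonneg_left (hX h1) (by linarith)
      _ = C * (h * h ^ (-θ) - h) := by ring
      _ ≤ C * θ := mul_le_mul_of_nonneg_left (by nlinarith) hC
      _ ≤ (C + H * Real.log H) * θ := by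
          nlinarith [mul_nonneg (mul_nonneg (zero_le_one.trans hH1) hlog) hθ0]
  · have hle : h ^ (-θ) ≤ 1 := Real.rpow_le_one_of_one_le_of_nonpos h1.le (by linarith)
    have hlogh : Real.log h ≤ Real.log H := Real.log_le_log hpos hH
    have hexp : 1 - θ * Real.log h ≤ h ^ (-θ) := by
      rw [Real.rpow_def_of_pos hpos]
      linarith [Real.add_one_le_exp (Real.log h * -θ)]
    rw [abs_of_nonpos (by linarith)]
    have : -(h ^ (-θ) - 1) ≤ θ * Real.log H := by nlinarith
    calc -(h ^ (-θ) - 1) * X ≤ (θ * Real.log H) * H := by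
          apply mul_le_mul this hXH hX0 (by positivity)
      _ ≤ (C + H * Real.log H) * θ := by nlinarith

theorem hmu_nonneg {c₁ c₂ : ℝ} (hc₁ : 0 ≤ c₁) (hc₂ : 0 ≤ c₂) (μ : ℝ) (ξ : Fin 2 → ℝ) :
    0 ≤ hmu c₁ c₂ μ ξ := by
  unfold hmu; positivity

/-- Weighted dilation of `ℝ³` with weights `(1 - μ, 1, 1 + μ)`. -/
noncomputable def dil (μ l : ℝ) (x : Fin 3 → ℝ) : Fin 3 → ℝ :=
  ![l ^ (1 - μ) * x 0, l * x 1, l ^ (1 + μ) * x 2]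

theorem hmu_dil {c₁ c₂ μ l : ℝ} (hμ : μ < 1) (hl : 0 < l) (a b : ℝ) :
    hmu c₁ c₂ μ ![l ^ (1 - μ) * a, l * b] = l * hmu c₁ c₂ μ ![a, b] := by
  have h1 : (1 - μ) * (1 / (1 - μ)) = 1 := by
    have : 1 - μ ≠ 0 := by linarith
    field_simp
  simp only [hmu, Matrix.cons_val_zero, Matrix.cons_val_one]
  rw [abs_mul, abs_mul, abs_of_pos hl, abs_of_pos (Real.rpow_pos_of_pos hl _),
    Real.mul_rpow (by positivity) (abs_nonneg _), ← Real.rpow_mul hl.le, h1, Real.rpow_one]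
  ring

/-- The closed-loop field is homogeneous of degree `μ`. -/
theorem gmu_dil {Kp Kd Ki c₁ c₂ μ l : ℝ} (hc₁ : 0 ≤ c₁) (hc₂ : 0 ≤ c₂) (hμ : μ < 1) (hl : 0 < l)
    (x : Fin 3 → ℝ) :
    gmu Kp Kd Ki c₁ c₂ μ (dil μ l x) = l ^ μ • dil μ l (gmu Kp Kd Ki c₁ c₂ μ x) := by
  have hh := hmu_nonneg hc₁ hc₂ μ ![x 0, x 1]
  have e1 : l ^ (1 - μ) = l * (l ^ μ)⁻¹ := by
    rw [sub_eq_add_neg, Real.rpow_add hl, Real.rpow_one, Real.rpow_neg hl.le]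
  have e2 : l ^ (1 + μ) = l * l ^ μ := by rw [Real.rpow_add hl, Real.rpow_one]
  have e3 : l ^ (2 * μ) = (l ^ μ) ^ 2 := by
    rw [mul_comm, Real.rpow_mul hl.le]; norm_cast
  have e4 : l ^ (3 * μ) = (l ^ μ) ^ 3 := by
    rw [mul_comm, Real.rpow_mul hl.le]; norm_cast
  have hlμ : l ^ μ ≠ 0 := (Real.rpow_pos_of_pos hl _).ne'
  ext i
  fin_cases i <;> simp [gmu, dil, hmu_dil hμ hl, Real.mul_rpow hl.le hh] <;>
    simp only [e1, e2, e3, e4] <;> field_simp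

/-- Differentiable solutions on `[0, ∞)` of the closed-loop system. -/
def IsSol (Kp Kd Ki c₁ c₂ μ : ℝ) (x : ℝ → (Fin 3 → ℝ)) : Prop :=
  ∀ t ≥ (0:ℝ), HasDerivWithinAt x (gmu Kp Kd Ki c₁ c₂ μ (x t)) (Set.Ici 0) t

/-- Rescaling space by `dil μ l` and time by `l ^ μ` preserves solutions. -/
theorem IsSol.rescale {Kp Kd Ki c₁ c₂ μ l t₀ : ℝ} {x : ℝ → (Fin 3 → ℝ)}
    (hx : IsSol Kp Kd Ki c₁ c₂ μ x) (hc₁ : 0 ≤ c₁) (hc₂ : 0 ≤ c₂) (hμ : μ < 1) (hl : 0 < l)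
    (ht₀ : 0 ≤ t₀) :
    IsSol Kp Kd Ki c₁ c₂ μ (fun t => dil μ l (x (t₀ + l ^ μ * t))) := by
  intro t ht
  have hσ : 0 < l ^ μ := Real.rpow_pos_of_pos hl _
  have hτ : 0 ≤ t₀ + l ^ μ * t := by have := mul_nonneg hσ.le ht; linarith
  have hlin : HasDerivWithinAt (fun t => t₀ + l ^ μ * t) (l ^ μ) (Set.Ici 0) t := by
    simpa using (((hasDerivAt_id t).const_mul (l ^ μ)).const_add t₀).hasDerivWithinAt
  have hcomp := (hx _ hτ).scomp t hlin (t' := Set.Ici 0) (fun s hs => by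
    have := mul_nonneg hσ.le (Set.mem_Ici.1 hs)
    exact Set.mem_Ici.2 (by linarith))
  rw [hasDerivWithinAt_pi] at hcomp ⊢
  rw [gmu_dil hc₁ hc₂ hμ hl]
  intro i
  have hi := hcomp i
  fin_cases i
  · exact (hi.const_mul (l ^ (1 - μ))).congr_deriv (by simp [dil]; ring)
  · exact (hi.const_mul l).congr_deriv (by simp [dil]; ring)
  · exact (hi.const_mul (l ^ (1 + μ))).congr_deriv (by simp [dil]; ring)

theorem le_one_of_deriv_neg {f f' : ℝ → ℝ}
    (hf : ∀ t ≥ (0:ℝ), HasDerivWithinAt f (f' t) (Set.Ici 0) t) (h0 : f 0 ≤ 1)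
    (h1 : ∀ t ≥ (0:ℝ), f t = 1 → f' t < 0) : ∀ t ≥ (0:ℝ), f t ≤ 1 := by
  intro t ht
  refine image_le_of_deriv_right_lt_deriv_boundary (f := f) (f' := f') (a := 0) (b := t)
    (B := fun _ => 1) (B' := fun _ => 0) ?_ ?_ h0 (fun _ => hasDerivAt_const _ _) ?_ ⟨ht, le_rfl⟩
  · exact fun s hs => (hf s hs.1).continuousWithinAt.mono Set.Icc_subset_Ici_self
  · exact fun s hs => (hf s hs.1).mono (Set.Ici_subset_Ici.2 hs.1)
  · exact fun s hs => h1 s hs.1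

theorem exists_le_of_deriv_le {f f' : ℝ → ℝ} {a κ : ℝ} (ha : 0 < a) (hκ : 0 < κ)
    (hf : ∀ t ≥ (0:ℝ), HasDerivWithinAt f (f' t) (Set.Ici 0) t) (h0 : f 0 ≤ 1)
    (h1 : ∀ t ≥ (0:ℝ), a ≤ f t → f' t ≤ -κ) : ∃ t ≥ (0:ℝ), t ≤ 1 / κ ∧ f t ≤ a := by
  by_contra! hcon
  have hκ' : 0 ≤ 1 / κ := by positivity
  have := image_le_of_deriv_right_le_deriv_boundary (f := f) (f' := f') (a := 0) (b := 1 / κ)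
    (B := fun t => 1 - κ * t) (B' := fun _ => -κ)
    (fun s hs => (hf s hs.1).continuousWithinAt.mono Set.Icc_subset_Ici_self)
    (fun s hs => (hf s hs.1).mono (Set.Ici_subset_Ici.2 hs.1)) (by simpa using h0)
    (by fun_prop)
    (fun s _ => by
      simpa using (((hasDerivAt_id s).const_mul κ).const_sub 1).hasDerivWithinAt)
    (fun s hs => h1 s hs.1 (hcon s hs.1 hs.2.le).le) (x := 1 / κ) ⟨hκ', le_rfl⟩
  have h2 := hcon (1 / κ) hκ' le_rfl
  have h3 : κ * (1 / κ) = 1 := by field_simp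
  linarith

/-- Near `μ = 0` the nonlinear gains are uniformly close to `1` on bounded sets, after
multiplication by the corresponding state. -/
theorem exists_gain_deviation_bound {c₁ c₂ R : ℝ} (hc₁ : 0 < c₁) (hc₂ : 0 < c₂) (hR : 1 ≤ R) :
    ∃ M ≥ (0:ℝ), ∀ μ : ℝ, -(1/4) < μ → μ < 0 → ∀ a b : ℝ, |a| ≤ R → |b| ≤ R →
      |hmu c₁ c₂ μ ![a, b] ^ μ - 1| * |b| ≤ M * -μ ∧
      |hmu c₁ c₂ μ ![a, b] ^ (2 * μ) - 1| * |a| ≤ M * -μ ∧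
      |hmu c₁ c₂ μ ![a, b] ^ (3 * μ) - 1| * |a| ≤ M * -μ := by
  obtain ⟨H, hH⟩ : ∃ H, H = (1 + c₁ + c₂) * R := ⟨_, rfl⟩
  obtain ⟨C, hC⟩ : ∃ C, C = 1 / c₁ * (1 + 1 / c₁) + 1 / c₂ := ⟨_, rfl⟩
  have hH1 : 1 ≤ H := by nlinarith
  have hRH : R ≤ H := by nlinarith
  have hC0 : 0 ≤ C := by rw [hC]; positivity
  have hK0 : 0 ≤ C + H * Real.log H := by
    have := Real.log_nonneg hH1
    positivity
  refine ⟨3 * (C + H * Real.log H), by positivity, fun μ hμ hμ0 a b ha hb => ?_⟩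
  have hq0 : 0 < 1 - μ := by linarith
  obtain ⟨y, hy⟩ : ∃ y, y = |a| ^ (1 / (1 - μ)) := ⟨_, rfl⟩
  have hy0 : 0 ≤ y := by rw [hy]; positivity
  have hay : |a| = y ^ (1 - μ) := by
    rw [hy, ← Real.rpow_mul (abs_nonneg a), one_div_mul_cancel hq0.ne', Real.rpow_one]
  have hyR : y ≤ R := by
    rw [hy]
    calc |a| ^ (1 / (1 - μ)) ≤ R ^ (1 / (1 - μ)) :=
          Real.rpow_le_rpow (abs_nonneg a) ha (by positivity)
      _ ≤ R ^ (1:ℝ) := Real.rpow_le_rpow_of_exponent_le hR (by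
          rw [div_le_one hq0]; linarith)
      _ = R := Real.rpow_one R
  have hay' : |a| ≤ y * (1 + y) := by
    rcases hy0.eq_or_lt with h0 | hpos
    · rw [hay, ← h0, Real.zero_rpow hq0.ne']; simp
    rw [hay, sub_eq_add_neg, Real.rpow_add hpos, Real.rpow_one]
    refine mul_le_mul_of_nonneg_left ?_ hy0
    rcases le_or_gt y 1 with h1 | h1
    · have := Real.rpow_le_one hy0 h1 (by linarith : 0 ≤ -μ)
      linarith
    · have := Real.rpow_le_rpow_of_exponent_le h1.le (by linarith : -μ ≤ 1)
      rw [Real.rpow_one] at this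
      linarith
  have hh : hmu c₁ c₂ μ ![a, b] = c₁ * y + c₂ * |b| := by simp [hmu, hy]
  generalize hmu c₁ c₂ μ ![a, b] = h at hh ⊢
  have hcb : 0 ≤ c₂ * |b| := by positivity
  have hcy : 0 ≤ c₁ * y := by positivity
  have h0 : 0 ≤ h := by linarith
  have hhH : h ≤ H := by
    have h1 := mul_le_mul_of_nonneg_left hyR hc₁.le
    have h2 := mul_le_mul_of_nonneg_left hb hc₂.le
    rw [hh, hH]; linarith
  have hyh : y ≤ 1 / c₁ * h := by
    rw [one_div, inv_mul_eq_div, le_div_iff₀ hc₁]; linarith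
  have hXb : h ≤ 1 → |b| ≤ C * h := fun _ => by
    have h1 : |b| ≤ 1 / c₂ * h := by
      rw [one_div, inv_mul_eq_div, le_div_iff₀ hc₂]; linarith
    have h2 : 0 ≤ 1 / c₁ * (1 + 1 / c₁) * h := by positivity
    rw [hC, add_mul]; linarith
  have hXa : h ≤ 1 → |a| ≤ C * h := fun h1 => by
    have h2 : 0 ≤ 1 / c₂ * h := by positivity
    have h3 : y ≤ 1 / c₁ := hyh.trans (mul_le_of_le_one_right (by positivity) h1)
    have h4 : y * (1 + y) ≤ (1 / c₁ * h) * (1 + 1 / c₁) :=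
      mul_le_mul hyh (by linarith) (by linarith) (by positivity)
    rw [hC, add_mul]; linarith
  have hKμ : 0 ≤ (C + H * Real.log H) * -μ := mul_nonneg hK0 (by linarith)
  have B1 := abs_rpow_neg_sub_one_mul_le h0 hhH hH1 (by linarith : 0 ≤ -μ) (by linarith)
    (abs_nonneg b) hXb (hb.trans hRH) hC0
  have B2 := abs_rpow_neg_sub_one_mul_le h0 hhH hH1 (by linarith : 0 ≤ -(2 * μ)) (by linarith)
    (abs_nonneg a) hXa (ha.trans hRH) hC0
  have B3 := abs_rpow_neg_sub_one_mul_le h0 hhH hH1 (by linarith : 0 ≤ -(3 * μ)) (by linarith)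
    (abs_nonneg a) hXa (ha.trans hRH) hC0
  rw [neg_neg] at B1 B2 B3
  exact ⟨by linarith, by linarith, by linarith⟩

/-- Quadratic Lyapunov function of the linear PID loop with characteristic polynomial
`(s + p)(s² + m s + n)`. -/
def pidV (p m n : ℝ) (x : Fin 3 → ℝ) : ℝ :=
  2 * n * (x 1 + p * x 0) ^ 2 + (x 2 - (p * m + n) * x 0 - m * x 1) ^ 2 +
    (x 2 - n * x 0) ^ 2 + m * n * p * x 0 ^ 2

/-- Derivative of `pidV p m n` at `x` in direction `v`. -/
def pidDV (p m n : ℝ) (x v : Fin 3 → ℝ) : ℝ :=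
  2 * n * (2 * (x 1 + p * x 0) * (v 1 + p * v 0)) +
    2 * (x 2 - (p * m + n) * x 0 - m * x 1) * (v 2 - (p * m + n) * v 0 - m * v 1) +
    2 * (x 2 - n * x 0) * (v 2 - n * v 0) + m * n * p * (2 * x 0 * v 0)

theorem hasDerivWithinAt_pidV {p m n t : ℝ} {x : ℝ → (Fin 3 → ℝ)} {v : Fin 3 → ℝ} {s : Set ℝ}
    (hx : HasDerivWithinAt x v s t) :
    HasDerivWithinAt (fun t => pidV p m n (x t)) (pidDV p m n (x t) v) s t := by
  rw [hasDerivWithinAt_pi] at hx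
  have h0 := hx 0
  have h1 := hx 1
  have h2 := hx 2
  have := (((((h1.add (h0.const_mul p)).pow 2).const_mul (2 * n)).add
    (((h2.sub (h0.const_mul (p * m + n))).sub (h1.const_mul m)).pow 2)).add
    ((h2.sub (h0.const_mul n)).pow 2)).add ((h0.pow 2).const_mul (m * n * p))
  exact this.congr_deriv (by simp [pidDV])

theorem exists_pidV_bounds {p m n : ℝ} (hp : 0 < p) (hm : 0 < m) (hn : 0 < n) :
    ∃ k > (0:ℝ), ∀ x : Fin 3 → ℝ, pidV p m n x ≤ k * ∑ i, x i ^ 2 ∧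
      ∑ i, x i ^ 2 ≤ k * pidV p m n x := by
  have hδ : 0 < m * n * p := by positivity
  obtain ⟨d, hd⟩ : ∃ d, d = 1 / (m * n * p) := ⟨_, rfl⟩
  obtain ⟨e, he⟩ : ∃ e, e = 1 / n := ⟨_, rfl⟩
  have hd0 : 0 < d := by rw [hd]; positivity
  have he0 : 0 < e := by rw [he]; positivity
  have hd1 : d * (m * n * p) = 1 := by rw [hd]; field_simp
  have he1 : e * n = 1 := by rw [he]; field_simp
  obtain ⟨k₁, hk₁⟩ : ∃ k, k = 4 * n * (1 + p ^ 2) + 3 * (1 + (p * m + n) ^ 2 + m ^ 2) +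
    2 * (1 + n ^ 2) + m * n * p := ⟨_, rfl⟩
  obtain ⟨k₂, hk₂⟩ : ∃ k, k = d + (e + 2 * p ^ 2 * d) + (2 + 2 * n ^ 2 * d) := ⟨_, rfl⟩
  have hk₁0 : 0 < k₁ := by rw [hk₁]; positivity
  have hk₂0 : 0 < k₂ := by rw [hk₂]; positivity
  refine ⟨k₁ + k₂, by positivity, fun x => ?_⟩
  have hV0 : 0 ≤ pidV p m n x := by unfold pidV; positivity
  have hN0 : 0 ≤ ∑ i, x i ^ 2 := Finset.sum_nonneg fun i _ => sq_nonneg _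
  suffices h : pidV p m n x ≤ k₁ * ∑ i, x i ^ 2 ∧ ∑ i, x i ^ 2 ≤ k₂ * pidV p m n x by
    constructor
    · nlinarith [h.1]
    · nlinarith [h.2]
  rw [Fin.sum_univ_three]
  constructor
  · have a1 : (x 1 + p * x 0) ^ 2 ≤ 2 * (1 + p ^ 2) * (x 0 ^ 2 + x 1 ^ 2 + x 2 ^ 2) := by
      nlinarith [sq_nonneg (x 1 - p * x 0), sq_nonneg (p * x 1), sq_nonneg (x 0), sq_nonneg (x 2),
        sq_nonneg (p * x 2)]
    have a2 : (x 2 - (p * m + n) * x 0 - m * x 1) ^ 2 ≤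
        3 * (1 + (p * m + n) ^ 2 + m ^ 2) * (x 0 ^ 2 + x 1 ^ 2 + x 2 ^ 2) := by
      generalize p * m + n = q
      nlinarith [sq_nonneg (x 2 + q * x 0), sq_nonneg (x 2 + m * x 1),
        sq_nonneg (q * x 0 - m * x 1), sq_nonneg (q * x 1), sq_nonneg (q * x 2),
        sq_nonneg (m * x 0), sq_nonneg (m * x 2), sq_nonneg (x 0), sq_nonneg (x 1)]
    have a3 : (x 2 - n * x 0) ^ 2 ≤ 2 * (1 + n ^ 2) * (x 0 ^ 2 + x 1 ^ 2 + x 2 ^ 2) := by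
      nlinarith [sq_nonneg (x 2 + n * x 0), sq_nonneg (n * x 1), sq_nonneg (x 0), sq_nonneg (x 1),
        sq_nonneg (n * x 2)]
    have a4 : x 0 ^ 2 ≤ x 0 ^ 2 + x 1 ^ 2 + x 2 ^ 2 := by
      linarith [sq_nonneg (x 1), sq_nonneg (x 2)]
    have b1 := mul_le_mul_of_nonneg_left a1 (by positivity : 0 ≤ 2 * n)
    have b4 := mul_le_mul_of_nonneg_left a4 hδ.le
    rw [pidV, hk₁]
    linarith
  · obtain ⟨V, hV⟩ : ∃ V, V = pidV p m n x := ⟨_, rfl⟩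
    rw [← hV]
    unfold pidV at hV
    have q1 := mul_nonneg (by positivity : 0 ≤ 2 * n) (sq_nonneg (x 1 + p * x 0))
    have q2 := sq_nonneg (x 2 - (p * m + n) * x 0 - m * x 1)
    have q3 := sq_nonneg (x 2 - n * x 0)
    have q4 := mul_nonneg hδ.le (sq_nonneg (x 0))
    have x0 : x 0 ^ 2 ≤ d * V := by
      have := mul_le_mul_of_nonneg_left (by linarith : m * n * p * x 0 ^ 2 ≤ V) hd0.le
      rwa [← mul_assoc, hd1, one_mul] at this
    have hu : 2 * (x 1 + p * x 0) ^ 2 ≤ e * V := by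
      have := mul_le_mul_of_nonneg_left (by linarith : 2 * n * (x 1 + p * x 0) ^ 2 ≤ V) he0.le
      calc 2 * (x 1 + p * x 0) ^ 2 = (e * n) * (2 * (x 1 + p * x 0) ^ 2) := by rw [he1, one_mul]
        _ = e * (2 * n * (x 1 + p * x 0) ^ 2) := by ring
        _ ≤ _ := this
    have x1 : x 1 ^ 2 ≤ e * V + 2 * p ^ 2 * (d * V) := by
      linarith [sq_nonneg (x 1 + 2 * p * x 0), mul_le_mul_of_nonneg_left x0 (sq_nonneg p)]
    have x2 : x 2 ^ 2 ≤ 2 * V + 2 * n ^ 2 * (d * V) := by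
      linarith [sq_nonneg (x 2 - 2 * n * x 0), mul_le_mul_of_nonneg_left x0 (sq_nonneg n)]
    rw [hk₂]
    linarith

/-- Along the linear PID loop, `pidV` decays exponentially. -/
theorem exists_pidDV_linear_le {p m n : ℝ} (hp : 0 < p) (hm : 0 < m) (hn : 0 < n) :
    ∃ k > (0:ℝ), ∀ x : Fin 3 → ℝ,
      pidDV p m n x ![x 1, -(p * m + n) * x 0 + -(p + m) * x 1 + x 2, -(p * n) * x 0] ≤
        -k * pidV p m n x := by
  obtain ⟨k, hk0, hk1, hk2, hk3⟩ : ∃ k > (0:ℝ), 3 * k ≤ 2 * m ∧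
      (2 * n + 2 * m ^ 2) * k ≤ m * n ∧ k ≤ p := by
    refine ⟨min (min (2 * m / 3) (m * n / (2 * n + 2 * m ^ 2))) p, by positivity, ?_, ?_, ?_⟩
    · rw [mul_comm, ← le_div_iff₀ (by norm_num)]
      exact (min_le_left _ _).trans (min_le_left _ _)
    · rw [mul_comm, ← le_div_iff₀ (by positivity)]
      exact (min_le_left _ _).trans (min_le_right _ _)
    · exact min_le_right _ _
  refine ⟨k, hk0, fun x => ?_⟩
  obtain ⟨u, hu⟩ : ∃ u, u = x 1 + p * x 0 := ⟨_, rfl⟩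
  obtain ⟨v, hv⟩ : ∃ v, v = x 2 - (p * m + n) * x 0 - m * x 1 := ⟨_, rfl⟩
  have hV : pidV p m n x = 2 * n * u ^ 2 + v ^ 2 + (v + m * u) ^ 2 + m * n * p * x 0 ^ 2 := by
    rw [pidV, hu, hv]; ring
  have hD : pidDV p m n x
      ![x 1, -(p * m + n) * x 0 + -(p + m) * x 1 + x 2, -(p * n) * x 0] =
      -(2 * m * v ^ 2) - m * n * u ^ 2 - m * n * (p * x 0) ^ 2 - m * n * (u - p * x 0) ^ 2 := by
    simp [pidDV, hu, hv]; ring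
  have hVle : pidV p m n x ≤ (2 * n + 2 * m ^ 2) * u ^ 2 + 3 * v ^ 2 + m * n * p * x 0 ^ 2 := by
    rw [hV]; nlinarith [sq_nonneg (v - m * u)]
  have h1 := mul_le_mul_of_nonneg_left hVle hk0.le
  have h2 := mul_le_mul_of_nonneg_right hk1 (sq_nonneg v)
  have h3 := mul_le_mul_of_nonneg_right hk2 (sq_nonneg u)
  have h4 := mul_le_mul_of_nonneg_right hk3 (by positivity : 0 ≤ m * n * p * x 0 ^ 2)
  have h5 : 0 ≤ m * n * (u - p * x 0) ^ 2 := by positivity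
  rw [hD]
  linarith

/-- For `μ` near `0`, `pidV` strictly decreases along the nonlinear loop on `a ≤ pidV ≤ 1`. -/
theorem exists_pidDV_gmu_le {p m n c₁ c₂ a : ℝ} (hp : 0 < p) (hm : 0 < m) (hn : 0 < n)
    (hc₁ : 0 < c₁) (hc₂ : 0 < c₂) (ha : 0 < a) :
    ∃ ε > (0:ℝ), ε ≤ 1/2 ∧ ∃ κ > (0:ℝ), ∀ μ : ℝ, -ε < μ → μ < 0 → ∀ x : Fin 3 → ℝ,
      a ≤ pidV p m n x → pidV p m n x ≤ 1 →
      pidDV p m n x (gmu (-(p * m + n)) (-(p + m)) (-(p * n)) c₁ c₂ μ x) ≤ -κ := by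
  obtain ⟨k, hk, hkV⟩ := exists_pidV_bounds hp hm hn
  obtain ⟨κ, hκ, hlin⟩ := exists_pidDV_linear_le hp hm hn
  obtain ⟨M, hM, hdev⟩ := exists_gain_deviation_bound hc₁ hc₂ (by linarith : 1 ≤ 1 + k)
  obtain ⟨B, hB⟩ : ∃ B, B = (1 + 2 * n + 2 * m) * (((p * m + n) + (p + m)) * M) +
    4 * (p * n * M) := ⟨_, rfl⟩
  have hB0 : 0 ≤ B := by rw [hB]; positivity
  refine ⟨min (1 / 4) (κ * a / (2 * (B + 1))), by positivity,
    (min_le_left _ _).trans (by norm_num), κ * a / 2, by positivity, fun μ hμ hμ0 x hax hx1 => ?_⟩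
  have hμ4 : -(1 / 4) < μ := by linarith [min_le_left (1 / 4) (κ * a / (2 * (B + 1)))]
  have hBμ : B * -μ ≤ κ * a / 2 := by
    have h1 : -μ ≤ κ * a / (2 * (B + 1)) := by
      linarith [min_le_right (1 / 4) (κ * a / (2 * (B + 1)))]
    rw [le_div_iff₀ (by positivity)] at h1
    nlinarith
  have hN := (hkV x).2
  rw [Fin.sum_univ_three] at hN
  have hN1 : x 0 ^ 2 + x 1 ^ 2 + x 2 ^ 2 ≤ k := hN.trans (mul_le_of_le_one_right hk.le hx1)
  have hx0R : |x 0| ≤ 1 + k := abs_le_of_sq_le_sq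
    (by nlinarith [sq_nonneg (x 1), sq_nonneg (x 2)]) (by linarith)
  have hx1R : |x 1| ≤ 1 + k := abs_le_of_sq_le_sq
    (by nlinarith [sq_nonneg (x 0), sq_nonneg (x 2)]) (by linarith)
  obtain ⟨d1, d2, d3⟩ := hdev μ hμ4 hμ0 (x 0) (x 1) hx0R hx1R
  rw [← abs_mul] at d1 d2 d3
  obtain ⟨u, hu⟩ : ∃ u, u = x 1 + p * x 0 := ⟨_, rfl⟩
  obtain ⟨v, hv⟩ : ∃ v, v = x 2 - (p * m + n) * x 0 - m * x 1 := ⟨_, rfl⟩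
  obtain ⟨w, hw⟩ : ∃ w, w = x 2 - n * x 0 := ⟨_, rfl⟩
  have hV : pidV p m n x = 2 * n * u ^ 2 + v ^ 2 + w ^ 2 + m * n * p * x 0 ^ 2 := by
    rw [pidV, hu, hv, hw]
  have q1 : 0 ≤ 2 * n * u ^ 2 := by positivity
  have q4 : 0 ≤ m * n * p * x 0 ^ 2 := by positivity
  have hv1 : |v| ≤ 1 := abs_le_of_sq_le_sq (by linarith [sq_nonneg w]) zero_le_one
  have hw1 : |w| ≤ 1 := abs_le_of_sq_le_sq (by linarith [sq_nonneg v]) zero_le_one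
  have hu1 : |4 * n * u| ≤ 1 + 2 * n := by
    rw [abs_le]
    constructor <;> linarith [sq_nonneg v, sq_nonneg w, mul_nonneg hn.le (sq_nonneg (u - 1)),
      mul_nonneg hn.le (sq_nonneg (u + 1))]
  rw [abs_le] at hv1 hw1 hu1
  have g2 : |4 * n * u - 2 * m * v| ≤ 1 + 2 * n + 2 * m := by
    have h1 := mul_le_mul_of_nonneg_left hv1.1 hm.le
    have h2 := mul_le_mul_of_nonneg_left hv1.2 hm.le
    rw [abs_le]; constructor <;> linarith
  have g3 : |2 * v + 2 * w| ≤ 4 := by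
    rw [abs_le]; constructor <;> linarith
  obtain ⟨e₁, he₁⟩ : ∃ e, e = (hmu c₁ c₂ μ ![x 0, x 1] ^ μ - 1) * x 1 := ⟨_, rfl⟩
  obtain ⟨e₂, he₂⟩ : ∃ e, e = (hmu c₁ c₂ μ ![x 0, x 1] ^ (2 * μ) - 1) * x 0 := ⟨_, rfl⟩
  obtain ⟨e₃, he₃⟩ : ∃ e, e = (hmu c₁ c₂ μ ![x 0, x 1] ^ (3 * μ) - 1) * x 0 := ⟨_, rfl⟩
  rw [← he₁] at d1
  rw [← he₂] at d2
  rw [← he₃] at d3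
  have hsplit : pidDV p m n x (gmu (-(p * m + n)) (-(p + m)) (-(p * n)) c₁ c₂ μ x) =
      pidDV p m n x ![x 1, -(p * m + n) * x 0 + -(p + m) * x 1 + x 2, -(p * n) * x 0] +
      ((4 * n * u - 2 * m * v) * (-(p * m + n) * e₂ + -(p + m) * e₁) +
        (2 * v + 2 * w) * (-(p * n) * e₃)) := by
    simp only [pidDV, gmu, Matrix.cons_val, hu, hv, hw, he₁, he₂, he₃]
    ring
  have f2 : |-(p * m + n) * e₂ + -(p + m) * e₁| ≤ ((p * m + n) + (p + m)) * M * -μ := by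
    refine (abs_add_le _ _).trans ?_
    rw [abs_mul, abs_mul, abs_neg, abs_neg, abs_of_pos (by positivity : 0 < p * m + n),
      abs_of_pos (by positivity : 0 < p + m)]
    have h1 := mul_le_mul_of_nonneg_left d2 (by positivity : 0 ≤ p * m + n)
    have h2 := mul_le_mul_of_nonneg_left d1 (by positivity : 0 ≤ p + m)
    linarith
  have f3 : |-(p * n) * e₃| ≤ p * n * M * -μ := by
    rw [abs_mul, abs_neg, abs_of_pos (by positivity : 0 < p * n)]
    have h1 := mul_le_mul_of_nonneg_left d3 (by positivity : 0 ≤ p * n)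
    linarith
  have t2 := (le_abs_self _).trans ((abs_mul _ _).trans_le
    (mul_le_mul g2 f2 (abs_nonneg _) (by positivity)))
  have t3 := (le_abs_self _).trans ((abs_mul _ _).trans_le
    (mul_le_mul g3 f3 (abs_nonneg _) (by norm_num)))
  have hBe : B * -μ = (1 + 2 * n + 2 * m) * (((p * m + n) + (p + m)) * M * -μ) +
    4 * (p * n * M * -μ) := by rw [hB]; ring
  have hl := hlin x
  have hκa := mul_le_mul_of_nonneg_left hax hκ.le
  rw [hsplit]
  linarith

theorem dil_dil {μ l l' : ℝ} (hl : 0 ≤ l) (hl' : 0 ≤ l') (x : Fin 3 → ℝ) :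
    dil μ l (dil μ l' x) = dil μ (l * l') x := by
  ext i
  fin_cases i <;> simp [dil, Real.mul_rpow hl hl'] <;> ring

theorem sum_sq_dil {μ l : ℝ} (hl : 0 < l) (x : Fin 3 → ℝ) :
    ∑ i, dil μ l x i ^ 2 =
      l ^ (2 * (1 - μ)) * x 0 ^ 2 + l ^ (2:ℝ) * x 1 ^ 2 + l ^ (2 * (1 + μ)) * x 2 ^ 2 := by
  have h : ∀ s : ℝ, l ^ (2 * s) = (l ^ s) ^ 2 := fun s => by
    rw [mul_comm, Real.rpow_mul hl.le]; norm_cast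
  rw [Fin.sum_univ_three, h, h]
  simp [dil]
  ring

theorem le_sum_sq_dil {μ l : ℝ} (hμ : -(1/2) ≤ μ) (hμ0 : μ ≤ 0) (hl : 1 ≤ l) (x : Fin 3 → ℝ) :
    l * ∑ i, x i ^ 2 ≤ ∑ i, dil μ l x i ^ 2 := by
  have h : ∀ s : ℝ, 1 ≤ s → ∀ y : ℝ, l * y ^ 2 ≤ l ^ s * y ^ 2 := fun s hs y => by
    have := Real.rpow_le_rpow_of_exponent_le hl hs
    rw [Real.rpow_one] at this
    exact mul_le_mul_of_nonneg_right this (sq_nonneg y)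
  rw [sum_sq_dil (by linarith), Fin.sum_univ_three]
  linarith [h (2 * (1 - μ)) (by linarith) (x 0), h 2 (by norm_num) (x 1),
    h (2 * (1 + μ)) (by linarith) (x 2)]

theorem sum_sq_dil_le {μ l : ℝ} (hμ : -(1/2) ≤ μ) (hμ0 : μ ≤ 0) (hl : 1 ≤ l) (x : Fin 3 → ℝ) :
    ∑ i, dil μ l x i ^ 2 ≤ l ^ 3 * ∑ i, x i ^ 2 := by
  have h : ∀ s : ℝ, s ≤ 3 → ∀ y : ℝ, l ^ s * y ^ 2 ≤ l ^ 3 * y ^ 2 := fun s hs y => by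
    have := Real.rpow_le_rpow_of_exponent_le hl hs
    rw [show (3:ℝ) = ((3:ℕ):ℝ) by norm_num, Real.rpow_natCast] at this
    exact mul_le_mul_of_nonneg_right this (sq_nonneg y)
  rw [sum_sq_dil (by linarith), Fin.sum_univ_three]
  linarith [h (2 * (1 - μ)) (by linarith) (x 0), h 2 (by norm_num) (x 1),
    h (2 * (1 + μ)) (by linarith) (x 2)]

theorem sum_sq_dil_le_of_le_one {μ l : ℝ} (hμ : -(1/2) ≤ μ) (hμ0 : μ ≤ 0) (hl0 : 0 < l)
    (hl : l ≤ 1) (x : Fin 3 → ℝ) : ∑ i, dil μ l x i ^ 2 ≤ l * ∑ i, x i ^ 2 := by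
  have h : ∀ s : ℝ, 1 ≤ s → ∀ y : ℝ, l ^ s * y ^ 2 ≤ l * y ^ 2 := fun s hs y => by
    have := Real.rpow_le_rpow_of_exponent_ge hl0 hl hs
    rw [Real.rpow_one] at this
    exact mul_le_mul_of_nonneg_right this (sq_nonneg y)
  rw [sum_sq_dil hl0, Fin.sum_univ_three]
  linarith [h (2 * (1 - μ)) (by linarith) (x 0), h 2 (by norm_num) (x 1),
    h (2 * (1 + μ)) (by linarith) (x 2)]

section Dynamics

variable {Kp Kd Ki c₁ c₂ μ p m n a κ : ℝ} {x : ℝ → (Fin 3 → ℝ)}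

/-- Dilated sublevel sets `pidV ∘ dil μ l ≤ 1` are forward invariant. -/
theorem IsSol.pidV_dil_le_one (hx : IsSol Kp Kd Ki c₁ c₂ μ x) (hc₁ : 0 ≤ c₁) (hc₂ : 0 ≤ c₂)
    (hμ : μ < 1) (hκ : 0 < κ) (ha : a ≤ 1)
    (hdec : ∀ y, a ≤ pidV p m n y → pidV p m n y ≤ 1 →
      pidDV p m n y (gmu Kp Kd Ki c₁ c₂ μ y) ≤ -κ)
    {l t₀ t : ℝ} (hl : 0 < l) (ht₀ : 0 ≤ t₀) (h0 : pidV p m n (dil μ l (x t₀)) ≤ 1)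
    (ht : t₀ ≤ t) : pidV p m n (dil μ l (x t)) ≤ 1 := by
  have hσ : 0 < l ^ μ := Real.rpow_pos_of_pos hl _
  have hz := hx.rescale hc₁ hc₂ hμ hl ht₀
  have := le_one_of_deriv_neg (fun t ht => hasDerivWithinAt_pidV (p := p) (m := m) (n := n)
    (hz t ht)) (by simpa using h0)
    (fun s _ hs1 => (hdec _ (by rw [hs1]; exact ha) hs1.le).trans_lt (by linarith))
    ((t - t₀) / l ^ μ) (div_nonneg (by linarith) hσ.le)
  rwa [mul_div_cancel₀ _ hσ.ne', add_sub_cancel] at this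

/-- A solution in a dilated sublevel set enters the next smaller one within time `l ^ μ / κ`. -/
theorem IsSol.exists_pidV_dil_two_mul_le_one (hx : IsSol Kp Kd Ki c₁ c₂ μ x) (hc₁ : 0 ≤ c₁)
    (hc₂ : 0 ≤ c₂) (hμ : μ < 1) (hκ : 0 < κ) (ha0 : 0 < a) (ha : a ≤ 1)
    (hdec : ∀ y, a ≤ pidV p m n y → pidV p m n y ≤ 1 →
      pidDV p m n y (gmu Kp Kd Ki c₁ c₂ μ y) ≤ -κ)
    (hdil : ∀ y, pidV p m n y ≤ a → pidV p m n (dil μ 2 y) ≤ 1)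
    {l t₀ : ℝ} (hl : 0 < l) (ht₀ : 0 ≤ t₀) (h0 : pidV p m n (dil μ l (x t₀)) ≤ 1) :
    ∃ t ≥ t₀, t ≤ t₀ + l ^ μ * (1 / κ) ∧ pidV p m n (dil μ (2 * l) (x t)) ≤ 1 := by
  have hσ : 0 < l ^ μ := Real.rpow_pos_of_pos hl _
  have hz := hx.rescale hc₁ hc₂ hμ hl ht₀
  obtain ⟨t, ht0, htκ, hta⟩ := exists_le_of_deriv_le ha0 hκ
    (fun t ht => hasDerivWithinAt_pidV (p := p) (m := m) (n := n) (hz t ht)) (by simpa using h0)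
    (fun s hs hsa => hdec _ hsa (hx.pidV_dil_le_one hc₁ hc₂ hμ hκ ha hdec hl ht₀ h0
      (by linarith [mul_nonneg hσ.le hs])))
  refine ⟨t₀ + l ^ μ * t, by linarith [mul_nonneg hσ.le ht0],
    by linarith [mul_le_mul_of_nonneg_left htκ hσ.le], ?_⟩
  rw [← dil_dil zero_le_two hl.le]
  exact hdil _ hta

/-- Convergence to the origin in finite time, from any initial condition. -/
theorem IsSol.exists_forall_ge_eq_zero (hx : IsSol Kp Kd Ki c₁ c₂ μ x) (hc₁ : 0 ≤ c₁)
    (hc₂ : 0 ≤ c₂) (hμ2 : -(1/2) ≤ μ) (hμ0 : μ < 0) (hκ : 0 < κ) (ha0 : 0 < a) (ha : a ≤ 1)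
    (hdec : ∀ y, a ≤ pidV p m n y → pidV p m n y ≤ 1 →
      pidDV p m n y (gmu Kp Kd Ki c₁ c₂ μ y) ≤ -κ)
    (hdil : ∀ y, pidV p m n y ≤ a → pidV p m n (dil μ 2 y) ≤ 1)
    {k : ℝ} (hk : 0 < k) (hkV : ∀ y, pidV p m n y ≤ k * ∑ i, y i ^ 2 ∧
      ∑ i, y i ^ 2 ≤ k * pidV p m n y) :
    ∃ T ≥ (0:ℝ), ∀ t ≥ T, x t = 0 := by
  have hμ1 : μ < 1 := by linarith
  obtain ⟨l, hl⟩ : ∃ l, l = 1 / (1 + k * ∑ i, x 0 i ^ 2) := ⟨_, rfl⟩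
  have hkN : 0 ≤ k * ∑ i, x 0 i ^ 2 := mul_nonneg hk.le (Finset.sum_nonneg fun i _ => sq_nonneg _)
  have hl0 : 0 < l := by rw [hl]; positivity
  have hl1 : l ≤ 1 := by rw [hl, div_le_one (by positivity)]; linarith
  have hstart : pidV p m n (dil μ l (x 0)) ≤ 1 := by
    have h1 := mul_le_mul_of_nonneg_left (sum_sq_dil_le_of_le_one hμ2 hμ0.le hl0 hl1 (x 0)) hk.le
    have h2 : l * (1 + k * ∑ i, x 0 i ^ 2) = 1 := by rw [hl]; field_simp
    linarith [(hkV (dil μ l (x 0))).1]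
  obtain ⟨q, hq⟩ : ∃ q, q = (2:ℝ) ^ μ := ⟨_, rfl⟩
  have hq0 : 0 < q := by rw [hq]; positivity
  have hq1 : q < 1 := by rw [hq]; exact Real.rpow_lt_one_of_one_lt_of_neg one_lt_two hμ0
  obtain ⟨σ, hσ⟩ : ∃ σ, σ = l ^ μ * (1 / κ) := ⟨_, rfl⟩
  have hσ0 : 0 < σ := by rw [hσ]; positivity
  have hiter : ∀ j : ℕ, ∃ t ≥ (0:ℝ), t ≤ σ * ∑ i ∈ Finset.range j, q ^ i ∧
      pidV p m n (dil μ (2 ^ j * l) (x t)) ≤ 1 := by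
    intro j
    induction j with
    | zero => exact ⟨0, le_rfl, by simp, by simpa using hstart⟩
    | succ j ih =>
      obtain ⟨t, ht0, htle, htV⟩ := ih
      obtain ⟨t', ht', htle', htV'⟩ := hx.exists_pidV_dil_two_mul_le_one hc₁ hc₂ hμ1 hκ ha0 ha
        hdec hdil (by positivity : 0 < 2 ^ j * l) ht0 htV
      refine ⟨t', ht0.trans ht', ?_, ?_⟩
      · have hpow : (2 ^ j * l) ^ μ * (1 / κ) = σ * q ^ j := by
          rw [Real.mul_rpow (by positivity) hl0.le, hσ, hq, ← Real.rpow_natCast 2 j,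
            ← Real.rpow_mul zero_le_two, mul_comm (j:ℝ) μ, Real.rpow_mul zero_le_two,
            Real.rpow_natCast]
          ring
        rw [Finset.sum_range_succ, mul_add]
        linarith
      · rwa [pow_succ', mul_assoc]
  refine ⟨σ * (1 - q)⁻¹, mul_nonneg hσ0.le (inv_nonneg.2 (by linarith)), fun t ht => ?_⟩
  have hbound : ∀ j : ℕ, (2:ℝ) ^ j * ∑ i, dil μ l (x t) i ^ 2 ≤ k := by
    intro j
    obtain ⟨s, hs0, hsle, hsV⟩ := hiter j
    have hgeom : ∑ i ∈ Finset.range j, q ^ i ≤ (1 - q)⁻¹ := by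
      rw [← tsum_geometric_of_lt_one hq0.le hq1]
      exact (summable_geometric_of_lt_one hq0.le hq1).sum_le_tsum _ fun i _ => by positivity
    have hst : s ≤ t := hsle.trans ((mul_le_mul_of_nonneg_left hgeom hσ0.le).trans ht)
    have hV := hx.pidV_dil_le_one hc₁ hc₂ hμ1 hκ ha hdec (by positivity) hs0 hsV hst
    have h1 := le_sum_sq_dil hμ2 hμ0.le (one_le_pow₀ one_le_two : (1:ℝ) ≤ 2 ^ j) (dil μ l (x t))
    rw [dil_dil (by positivity) hl0.le] at h1
    exact h1.trans ((hkV _).2.trans (mul_le_of_le_one_right hk.le hV))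
  have hzero : ∑ i, dil μ l (x t) i ^ 2 = 0 := by
    refine le_antisymm ?_ (Finset.sum_nonneg fun i _ => sq_nonneg _)
    by_contra! hpos
    obtain ⟨j, hj⟩ := pow_unbounded_of_one_lt (k / ∑ i, dil μ l (x t) i ^ 2) one_lt_two
    rw [div_lt_iff₀ hpos] at hj
    exact absurd (hbound j) (not_le.2 hj)
  rw [Finset.sum_eq_zero_iff_of_nonneg fun i _ => sq_nonneg _] at hzero
  ext i
  have hi := hzero i (Finset.mem_univ i)
  have hl1 : l ^ (1 - μ) ≠ 0 := (Real.rpow_pos_of_pos hl0 _).ne'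
  have hl2 : l ^ (1 + μ) ≠ 0 := (Real.rpow_pos_of_pos hl0 _).ne'
  fin_cases i <;> simpa [dil, hl0.ne', hl1, hl2] using hi

/-- Lyapunov stability of the origin. -/
theorem exists_eucNorm3_le (hc₁ : 0 ≤ c₁) (hc₂ : 0 ≤ c₂) (hμ2 : -(1/2) ≤ μ) (hμ0 : μ < 0)
    (hκ : 0 < κ) (ha : a ≤ 1)
    (hdec : ∀ y, a ≤ pidV p m n y → pidV p m n y ≤ 1 →
      pidDV p m n y (gmu Kp Kd Ki c₁ c₂ μ y) ≤ -κ)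
    {k : ℝ} (hk : 0 < k) (hkV : ∀ y, pidV p m n y ≤ k * ∑ i, y i ^ 2 ∧
      ∑ i, y i ^ 2 ≤ k * pidV p m n y) {r : ℝ} (hr : 0 < r) :
    ∃ δ > (0:ℝ), ∀ x : ℝ → (Fin 3 → ℝ), IsSol Kp Kd Ki c₁ c₂ μ x →
      eucNorm3 (x 0) ≤ δ → ∀ t ≥ (0:ℝ), eucNorm3 (x t) ≤ r := by
  have hμ1 : μ < 1 := by linarith
  obtain ⟨l, hl1, hlr⟩ : ∃ l : ℝ, 1 ≤ l ∧ k ≤ l * r ^ 2 := by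
    refine ⟨1 + k / r ^ 2, by linarith [show 0 ≤ k / r ^ 2 by positivity], ?_⟩
    rw [add_mul, div_mul_cancel₀ _ (by positivity)]
    linarith [sq_nonneg r]
  have hl0 : 0 < l := by linarith
  have hkl : 0 < k * l ^ 3 := by positivity
  refine ⟨√(1 / (k * l ^ 3)), by positivity, fun x hx h0 t ht => ?_⟩
  have hN0 : ∑ i, x 0 i ^ 2 ≤ 1 / (k * l ^ 3) := by
    rwa [eucNorm3, Real.sqrt_le_sqrt_iff (by positivity)] at h0
  rw [le_div_iff₀ hkl] at hN0
  have hstart : pidV p m n (dil μ l (x 0)) ≤ 1 := by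
    have h1 := mul_le_mul_of_nonneg_left (sum_sq_dil_le hμ2 hμ0.le hl1 (x 0)) hk.le
    linarith [(hkV (dil μ l (x 0))).1]
  have hV := hx.pidV_dil_le_one hc₁ hc₂ hμ1 hκ ha hdec hl0 le_rfl hstart ht
  have h1 := (le_sum_sq_dil hμ2 hμ0.le hl1 (x t)).trans
    ((hkV _).2.trans (mul_le_of_le_one_right hk.le hV))
  rw [eucNorm3, Real.sqrt_le_left hr.le]
  exact le_of_mul_le_mul_left (h1.trans hlr) hl0

end Dynamics

/-- if the linear PID closed-loop matrix `A` is Hurwitz, then for the hPID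
built from the explicit norm `h_μ` there is `ε ∈ (0, 1/2]` such that for all
`μ ∈ (−ε, 0)` the system `ẋ = g_μ(x)` is globally finite-time stable: it is Lyapunov
stable, and every solution reaches `0` in finite time and stays there. -/
theorem hPID_finite_time_stable_negative_degree
    (Kp Kd Ki : ℝ)
    (A : Matrix (Fin 3) (Fin 3) ℝ)
    (hA : A = Matrix.of ![![0, 1, 0], ![Kp, Kd, 1], ![Ki, 0, 0]])
    (hHurwitz : ∀ z ∈ spectrum ℂ (A.map (algebraMap ℝ ℂ)), z.re < 0)
    (c₁ c₂ : ℝ) (hc₁ : 0 < c₁) (hc₂ : 0 < c₂) :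
    ∃ ε : ℝ, 0 < ε ∧ ε ≤ 1/2 ∧ ∀ μ : ℝ, -ε < μ → μ < 0 →
      ((∀ r > (0:ℝ), ∃ δ > (0:ℝ), ∀ x : ℝ → (Fin 3 → ℝ),
          (∀ t ≥ (0:ℝ), HasDerivWithinAt x (gmu Kp Kd Ki c₁ c₂ μ (x t)) (Set.Ici 0) t) →
          eucNorm3 (x 0) ≤ δ → ∀ t ≥ (0:ℝ), eucNorm3 (x t) ≤ r) ∧
       (∀ x : ℝ → (Fin 3 → ℝ),
          (∀ t ≥ (0:ℝ), HasDerivWithinAt x (gmu Kp Kd Ki c₁ c₂ μ (x t)) (Set.Ici 0) t) →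
          ∃ T ≥ (0:ℝ), ∀ t ≥ T, x t = 0)) := by
  subst hA
  obtain ⟨p, m, n, hp, hm, hn, rfl, rfl, rfl⟩ :=
    exists_pos_factor_of_hurwitz fun z hz => hHurwitz z (mem_spectrum_pid hz)
  obtain ⟨k, hk, hkV⟩ := exists_pidV_bounds hp hm hn
  obtain ⟨a, ha⟩ : ∃ a, a = 1 / (8 * k ^ 2 + 1) := ⟨_, rfl⟩
  have ha0 : 0 < a := by rw [ha]; positivity
  have ha1 : a ≤ 1 := by rw [ha, div_le_one (by positivity)]; linarith [sq_nonneg k]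
  obtain ⟨ε, hε, hε2, κ, hκ, hdec⟩ := exists_pidDV_gmu_le hp hm hn hc₁ hc₂ ha0
  refine ⟨ε, hε, hε2, fun μ hμ hμ0 => ?_⟩
  have hμ2 : -(1/2) ≤ μ := by linarith
  have hdil : ∀ y, pidV p m n y ≤ a → pidV p m n (dil μ 2 y) ≤ 1 := fun y hy => by
    have h1 := mul_le_mul_of_nonneg_left (sum_sq_dil_le hμ2 hμ0.le one_le_two y) hk.le
    have h2 := mul_le_mul_of_nonneg_left (hkV y).2 hk.le
    have h3 := mul_le_mul_of_nonneg_left hy (by positivity : 0 ≤ 8 * k ^ 2)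
    have h4 : (8 * k ^ 2 + 1) * a = 1 := by rw [ha]; field_simp
    linarith [(hkV (dil μ 2 y)).1]
  exact ⟨fun r hr => exists_eucNorm3_le hc₁.le hc₂.le hμ2 hμ0 hκ ha1 (hdec μ hμ hμ0) hk hkV hr,
    fun x hx => IsSol.exists_forall_ge_eq_zero hx hc₁.le hc₂.le hμ2 hμ0 hκ ha0 ha1
      (hdec μ hμ hμ0) hdil hk hkV⟩
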